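/- Proposition 1. For the Example-1 target distribution (X1,X2 independent uniform bits; Y = X1 if X2=1 and Y = 'e' if X2=0; no side information W), with perfect legitimate channel Ỹ = (X̃1,X̃2) and eavesdropper channel Z̃ = (X̃1, X̃2 ⊕ N), N ~ Bern(p) independent of (X̃1,X̃2), p ∈ [0,1/2]: secure channel simulation is feasible — i.e., there exists a pmf p(x1)p(x2)p(u1|x1)p(u2|x2)p(x̃1)p(x̃2)p(z̃|x̃1,x̃2)p(y|u1,u2) with (X1,X2,Y)-marginal equal to q satisfying H(X̃1) ≥ I(U1;X1), H(X̃2) ≥ I(U2;X2) and R01 ≥ I(U1;X1,Y|X2) − H(X̃1|Z̃) — if and only if H(X̃1) ≥ 1, H(X̃2) ≥ 1 (hence H(X̃1,X̃2) ≥ 2) and R01 ≥ 1, where entropies are in bits. -/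

import Mathlib

open scoped BigOperators

namespace SecCoord

/-- `p` is a probability mass function on the finite type `α`. -/
def IsPMF {α : Type*} [Fintype α] (p : α → ℝ) : Prop :=
  (∀ a, 0 ≤ p a) ∧ ∑ a, p a = 1

/-- Total variation distance between two pmfs: half the `ℓ¹`-distance. -/
noncomputable def TV {α : Type*} [Fintype α] (p q : α → ℝ) : ℝ :=
  (1 / 2) * ∑ a, |p a - q a|

/-- Distribution (pushforward pmf) of a random variable `X : Ω → α` under `μ`. -/
noncomputable def dist {Ω α : Type*} [Fintype Ω] (μ : Ω → ℝ) (X : Ω → α) : α → ℝ :=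
  fun a => ∑ ω, Set.indicator {ω' | X ω' = a} μ ω

/-- Shannon entropy (in bits) of the random variable `X` under `μ`. -/
noncomputable def H {Ω α : Type*} [Fintype Ω] [Fintype α] (μ : Ω → ℝ) (X : Ω → α) : ℝ :=
  -∑ a, dist μ X a * Real.logb 2 (dist μ X a)

/-- Conditional Shannon entropy `H(X | Z)` (in bits). -/
noncomputable def condEnt {Ω α β : Type*} [Fintype Ω] [Fintype α] [Fintype β]
    (μ : Ω → ℝ) (X : Ω → α) (Z : Ω → β) : ℝ :=
  H μ (fun ω => (X ω, Z ω)) - H μ Z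

/-- Mutual information `I(X; Y)` (in bits). -/
noncomputable def MI {Ω α β : Type*} [Fintype Ω] [Fintype α] [Fintype β]
    (μ : Ω → ℝ) (X : Ω → α) (Y : Ω → β) : ℝ :=
  H μ X + H μ Y - H μ (fun ω => (X ω, Y ω))

/-- Conditional mutual information `I(X; Y | Z)` (in bits). -/
noncomputable def CMI {Ω α β γ : Type*} [Fintype Ω] [Fintype α] [Fintype β] [Fintype γ]
    (μ : Ω → ℝ) (X : Ω → α) (Y : Ω → β) (Z : Ω → γ) : ℝ :=
  (H μ (fun ω => (X ω, Z ω))) + (H μ (fun ω => (Y ω, Z ω)))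
    - (H μ (fun ω => (X ω, Y ω, Z ω))) - H μ Z

section Example1

/-- The Example-1 target distribution `q_{X1 X2 Y}`: `X1, X2` are independent uniform
bits and `Y = X1` if `X2 = 1` (`true`), `Y = 'e'` (here `none`) if `X2 = 0`. -/
noncomputable def qEx : Bool × Bool × Option Bool → ℝ :=
  fun (x1, x2, y) => (1 / 4) * (if y = (if x2 then some x1 else none) then 1 else 0)

/-- The Example-1 eavesdropper channel `Z̃ = (X̃1, X̃2 ⊕ N)`, `N ∼ Bern(p)`
independent of `(X̃1, X̃2)`. -/
noncomputable def chZEx (p : ℝ) : Bool × Bool → Bool × Bool → ℝ :=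
  fun (a1, a2) (z1, z2) =>
    (if z1 = a1 then (1 : ℝ) else 0) * (if z2 = a2 then 1 - p else p)

/-- Sample space for Proposition 1: `(X1, X2, U1, U2, X̃1, X̃2, Z̃, Y)`. -/
abbrev Omega4 (U1 U2 : Type) : Type :=
  Bool × Bool × U1 × U2 × Bool × Bool × (Bool × Bool) × Option Bool

/-- The deterministic value of the target output. -/
def yOf (x1 x2 : Bool) : Option Bool := if x2 then some x1 else none

lemma dist_eq_ite {Ω α : Type*} [Fintype Ω] [DecidableEq α] (μ : Ω → ℝ) (X : Ω → α) (a : α) :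
    dist μ X a = ∑ ω, (if X ω = a then 1 else 0) * μ ω := by
  unfold dist
  refine Finset.sum_congr rfl fun ω _ => ?_
  by_cases h : X ω = a <;> simp [Set.indicator, h]

lemma H_eq_sum {Ω α : Type*} [Fintype Ω] [Fintype α] (μ : Ω → ℝ) (X : Ω → α) :
    H μ X = -∑ ω, μ ω * Real.logb 2 (dist μ X (X ω)) := by
  classical
  unfold H
  congr 1
  calc ∑ a, dist μ X a * Real.logb 2 (dist μ X a)
      = ∑ a, ∑ ω, ((if X ω = a then 1 else 0) * μ ω) * Real.logb 2 (dist μ X a) := by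
        refine Finset.sum_congr rfl fun a _ => ?_
        rw [← Finset.sum_mul, ← dist_eq_ite]
    _ = ∑ ω, ∑ a, ((if X ω = a then 1 else 0) * μ ω) * Real.logb 2 (dist μ X a) :=
        Finset.sum_comm
    _ = _ := by
        refine Finset.sum_congr rfl fun ω _ => ?_
        simp

/-- Entropy only depends on the partition of the support induced by the variable. -/
lemma H_congr {Ω α β : Type*} [Fintype Ω] [Fintype α] [Fintype β] (μ : Ω → ℝ)
    (X : Ω → α) (Y : Ω → β)
    (h : ∀ ω ω', μ ω ≠ 0 → μ ω' ≠ 0 → (X ω = X ω' ↔ Y ω = Y ω')) :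
    H μ X = H μ Y := by
  classical
  rw [H_eq_sum, H_eq_sum]
  congr 1
  refine Finset.sum_congr rfl fun ω _ => ?_
  by_cases h0 : μ ω = 0
  · simp [h0]
  · congr 2
    rw [dist_eq_ite, dist_eq_ite]
    refine Finset.sum_congr rfl fun ω' _ => ?_
    by_cases h1 : μ ω' = 0
    · simp [h1]
    · simp only [h ω' ω h1 h0]

lemma exists_ne_zero {α : Type*} [Fintype α] {f : α → ℝ} (h : IsPMF f) : ∃ a, f a ≠ 0 := by
  by_contra hc
  push Not at hc
  have := h.2
  simp [hc] at this

lemma sum_chZEx (p : ℝ) (a : Bool × Bool) : ∑ z, chZEx p a z = 1 := by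
  obtain ⟨a1, a2⟩ := a
  cases a1 <;> cases a2 <;> simp [chZEx, Fintype.sum_prod_type]

lemma dist_id {α : Type*} [Fintype α] (f : α → ℝ) : dist f (fun a => a) = f := by
  classical
  funext a
  rw [dist_eq_ite]
  simp

lemma H_prod (f g : Bool → ℝ) (hf : IsPMF f) (hg : IsPMF g) :
    H (fun v : Bool × Bool => f v.1 * g v.2) (fun v => v)
      = H f (fun a => a) + H g (fun a => a) := by
  have key : ∀ a b : Bool, f a * g b * Real.logb 2 (f a * g b)
      = f a * Real.logb 2 (f a) * g b + f a * (g b * Real.logb 2 (g b)) := by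
    intro a b
    by_cases ha : f a = 0
    · simp [ha]
    by_cases hb : g b = 0
    · simp [hb]
    rw [Real.logb_mul ha hb]; ring
  unfold H
  simp only [dist_id, Fintype.sum_prod_type, key, Finset.sum_add_distrib, ← Finset.mul_sum,
    ← Finset.sum_mul, hf.2, hg.2]
  ring

section Core

variable {U1 U2 : Type} [Fintype U1] [Fintype U2] {p : ℝ} {pXt1 pXt2 : Bool → ℝ}
  {pU1 : Bool → U1 → ℝ} {pU2 : Bool → U2 → ℝ} {pYc : U1 → U2 → Option Bool → ℝ}
  {μ : Omega4 U1 U2 → ℝ}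

lemma sum_weight (hU1 : ∀ x, IsPMF (pU1 x)) (hU2 : ∀ x, IsPMF (pU2 x))
    (hY : ∀ u1 u2, IsPMF (pYc u1 u2))
    (hμ : ∀ x1 x2 u1 u2 a1 a2 z y,
        μ (x1, x2, u1, u2, a1, a2, z, y) =
          (1 / 4) * pU1 x1 u1 * pU2 x2 u2 * pXt1 a1 * pXt2 a2 *
            chZEx p (a1, a2) z * pYc u1 u2 y)
    (g : Bool → Bool → Bool → Bool → ℝ) :
    ∑ ω : Omega4 U1 U2, g ω.1 ω.2.1 ω.2.2.2.2.1 ω.2.2.2.2.2.1 * μ ω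
      = ∑ x1, ∑ x2, ∑ a1, ∑ a2, g x1 x2 a1 a2 * ((1 / 4) * pXt1 a1 * pXt2 a2) := by
  have e : ∑ ω : Omega4 U1 U2, g ω.1 ω.2.1 ω.2.2.2.2.1 ω.2.2.2.2.2.1 * μ ω
      = ∑ x1, ∑ x2, ∑ u1, ∑ u2, ∑ a1, ∑ a2, ∑ z : Bool × Bool, ∑ y,
        g x1 x2 a1 a2 * μ (x1, x2, u1, u2, a1, a2, z, y) := by
    rw [Fintype.sum_prod_type]
    refine Finset.sum_congr rfl fun x1 _ => ?_
    rw [Fintype.sum_prod_type]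
    refine Finset.sum_congr rfl fun x2 _ => ?_
    rw [Fintype.sum_prod_type]
    refine Finset.sum_congr rfl fun u1 _ => ?_
    rw [Fintype.sum_prod_type]
    refine Finset.sum_congr rfl fun u2 _ => ?_
    rw [Fintype.sum_prod_type]
    refine Finset.sum_congr rfl fun a1 _ => ?_
    rw [Fintype.sum_prod_type]
    refine Finset.sum_congr rfl fun a2 _ => ?_
    rw [Fintype.sum_prod_type]
  rw [e]
  refine Finset.sum_congr rfl fun x1 _ => Finset.sum_congr rfl fun x2 _ => ?_
  have e2 : ∀ u1 u2, ∑ a1, ∑ a2, ∑ z : Bool × Bool, ∑ y,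
        g x1 x2 a1 a2 * μ (x1, x2, u1, u2, a1, a2, z, y)
      = pU1 x1 u1 * (pU2 x2 u2 * ∑ a1, ∑ a2, g x1 x2 a1 a2 * ((1 / 4) * pXt1 a1 * pXt2 a2)) := by
    intro u1 u2
    simp only [hμ]
    simp only [← Finset.mul_sum, (hY _ _).2, mul_one, sum_chZEx]
    simp only [Finset.mul_sum]
    refine Finset.sum_congr rfl fun a1 _ => Finset.sum_congr rfl fun a2 _ => ?_
    ring
  simp only [e2]
  simp only [← Finset.mul_sum, ← Finset.sum_mul, (hU1 _).2, (hU2 _).2, one_mul]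

lemma supp_y (hXt1 : IsPMF pXt1) (hXt2 : IsPMF pXt2)
    (hU1 : ∀ x, IsPMF (pU1 x)) (hU2 : ∀ x, IsPMF (pU2 x))
    (hY : ∀ u1 u2, IsPMF (pYc u1 u2))
    (hμ : ∀ x1 x2 u1 u2 a1 a2 z y,
        μ (x1, x2, u1, u2, a1, a2, z, y) =
          (1 / 4) * pU1 x1 u1 * pU2 x2 u2 * pXt1 a1 * pXt2 a2 *
            chZEx p (a1, a2) z * pYc u1 u2 y)
    (hq : ∀ x1 x2 y,
        (∑ u1 : U1, ∑ u2 : U2, ∑ a1 : Bool, ∑ a2 : Bool, ∑ z : Bool × Bool,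
          μ (x1, x2, u1, u2, a1, a2, z, y)) = qEx (x1, x2, y))
    (x1 x2 : Bool) (u1 : U1) (u2 : U2) (y : Option Bool)
    (h1 : pU1 x1 u1 ≠ 0) (h2 : pU2 x2 u2 ≠ 0) (h3 : pYc u1 u2 y ≠ 0) : y = yOf x1 x2 := by
  by_contra hne
  have e : ∀ u1 u2, ∑ a1 : Bool, ∑ a2 : Bool, ∑ z : Bool × Bool,
      μ (x1, x2, u1, u2, a1, a2, z, y) = (1 / 4) * pU1 x1 u1 * pU2 x2 u2 * pYc u1 u2 y := by
    intro u1 u2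
    simp only [hμ]
    simp only [← Finset.mul_sum, ← Finset.sum_mul, sum_chZEx, hXt1.2, hXt2.2, mul_one]
  have hq' := hq x1 x2 y
  simp only [e] at hq'
  have hz : qEx (x1, x2, y) = 0 := by
    have : ¬ (y = if x2 then some x1 else none) := hne
    simp only [qEx, if_neg this, mul_zero]
  rw [hz] at hq'
  have nn : ∀ u1 u2, 0 ≤ (1 / 4) * pU1 x1 u1 * pU2 x2 u2 * pYc u1 u2 y := fun u1 u2 =>
    mul_nonneg (mul_nonneg (mul_nonneg (by norm_num) ((hU1 _).1 _)) ((hU2 _).1 _)) ((hY _ _).1 _)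
  rw [Finset.sum_eq_zero_iff_of_nonneg (fun u _ => Finset.sum_nonneg fun v _ => nn u v)] at hq'
  have h' := hq' u1 (Finset.mem_univ _)
  rw [Finset.sum_eq_zero_iff_of_nonneg (fun v _ => nn u1 v)] at h'
  have h'' := h' u2 (Finset.mem_univ _)
  simp [h1, h2, h3] at h''

lemma core (hXt1 : IsPMF pXt1) (hXt2 : IsPMF pXt2)
    (hU1 : ∀ x, IsPMF (pU1 x)) (hU2 : ∀ x, IsPMF (pU2 x))
    (hY : ∀ u1 u2, IsPMF (pYc u1 u2))
    (hμ : ∀ x1 x2 u1 u2 a1 a2 z y,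
        μ (x1, x2, u1, u2, a1, a2, z, y) =
          (1 / 4) * pU1 x1 u1 * pU2 x2 u2 * pXt1 a1 * pXt2 a2 *
            chZEx p (a1, a2) z * pYc u1 u2 y)
    (hq : ∀ x1 x2 y,
        (∑ u1 : U1, ∑ u2 : U2, ∑ a1 : Bool, ∑ a2 : Bool, ∑ z : Bool × Bool,
          μ (x1, x2, u1, u2, a1, a2, z, y)) = qEx (x1, x2, y)) :
    H μ (fun ω => ω.2.2.2.2.1) = H pXt1 (fun a => a) ∧
    H μ (fun ω => ω.2.2.2.2.2.1) = H pXt2 (fun a => a) ∧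
    MI μ (fun ω => ω.2.2.1) (fun ω => ω.1) = 1 ∧
    MI μ (fun ω => ω.2.2.2.1) (fun ω => ω.2.1) = 1 ∧
    CMI μ (fun ω => ω.2.2.1) (fun ω => (ω.1, ω.2.2.2.2.2.2.2)) (fun ω => ω.2.1) = 1 ∧
    condEnt μ (fun ω => ω.2.2.2.2.1) (fun ω => ω.2.2.2.2.2.2.1) = 0 := by
  have W := sum_weight hU1 hU2 hY hμ
  have S := supp_y hXt1 hXt2 hU1 hU2 hY hμ hq
  have s1 := hXt1.2
  have s2 := hXt2.2
  rw [Fintype.sum_bool] at s1 s2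
  have t1 : pXt1 false = 1 - pXt1 true := by linarith
  have t2 : pXt2 false = 1 - pXt2 true := by linarith
  have D1 : ∀ a, dist μ (fun ω => ω.1) a = 1 / 2 := by
    intro a
    rw [dist_eq_ite, W (fun x1 _ _ _ => if x1 = a then 1 else 0)]
    cases a <;> simp [t1, t2] <;> ring
  have D2 : ∀ a, dist μ (fun ω => ω.2.1) a = 1 / 2 := by
    intro a
    rw [dist_eq_ite, W (fun _ x2 _ _ => if x2 = a then 1 else 0)]
    cases a <;> simp [t1, t2] <;> ring
  have D12 : ∀ a, dist μ (fun ω => (ω.1, ω.2.1)) a = 1 / 4 := by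
    intro a
    rw [dist_eq_ite, W (fun x1 x2 _ _ => if (x1, x2) = a then 1 else 0)]
    rcases a with ⟨_ | _, _ | _⟩ <;> simp [t1, t2] <;> ring
  have DA1 : dist μ (fun ω => ω.2.2.2.2.1) = pXt1 := by
    funext a
    rw [dist_eq_ite, W (fun _ _ a1 _ => if a1 = a then 1 else 0)]
    cases a <;> simp [t1, t2] <;> ring
  have DA2 : dist μ (fun ω => ω.2.2.2.2.2.1) = pXt2 := by
    funext a
    rw [dist_eq_ite, W (fun _ _ _ a2 => if a2 = a then 1 else 0)]
    cases a <;> simp [t1, t2] <;> ring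
  have l2 : Real.logb 2 (1 / 2) = -1 := by
    rw [one_div, Real.logb_inv, Real.logb_self_eq_one (by norm_num)]
  have l4 : Real.logb 2 (1 / 4) = -2 := by
    rw [show (1 / 4 : ℝ) = (1 / 2) * (1 / 2) by norm_num,
      Real.logb_mul (by norm_num) (by norm_num), l2]
    norm_num
  have H1 : H μ (fun ω => ω.1) = 1 := by
    unfold H; simp only [D1, l2, Fintype.sum_bool]; norm_num
  have H2 : H μ (fun ω => ω.2.1) = 1 := by
    unfold H; simp only [D2, l2, Fintype.sum_bool]; norm_num
  have H12 : H μ (fun ω => (ω.1, ω.2.1)) = 2 := by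
    unfold H; simp only [D12, l4, Fintype.sum_prod_type, Fintype.sum_bool]; norm_num
  have F1 : ∀ x1 x1' u1, pU1 x1 u1 ≠ 0 → pU1 x1' u1 ≠ 0 → x1 = x1' := by
    intro x1 x1' u1 h h'
    obtain ⟨u2, hu2⟩ := exists_ne_zero (hU2 true)
    obtain ⟨y, hy⟩ := exists_ne_zero (hY u1 u2)
    have e1 := S x1 true u1 u2 y h hu2 hy
    have e2 := S x1' true u1 u2 y h' hu2 hy
    rw [e1] at e2
    simpa [yOf] using e2
  have F2 : ∀ x2 x2' u2, pU2 x2 u2 ≠ 0 → pU2 x2' u2 ≠ 0 → x2 = x2' := by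
    intro x2 x2' u2 h h'
    obtain ⟨u1, hu1⟩ := exists_ne_zero (hU1 true)
    obtain ⟨y, hy⟩ := exists_ne_zero (hY u1 u2)
    have e1 := S true x2 u1 u2 y hu1 h hy
    have e2 := S true x2' u1 u2 y hu1 h' hy
    rw [e1] at e2
    cases x2 <;> cases x2' <;> simp [yOf] at e2 ⊢
  have supp : ∀ x1 x2 u1 u2 a1 a2 z1 z2 y, μ (x1, x2, u1, u2, a1, a2, (z1, z2), y) ≠ 0 →
      pU1 x1 u1 ≠ 0 ∧ pU2 x2 u2 ≠ 0 ∧ z1 = a1 ∧ y = yOf x1 x2 := by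
    intro x1 x2 u1 u2 a1 a2 z1 z2 y h
    rw [hμ] at h
    simp only [mul_ne_zero_iff] at h
    obtain ⟨⟨⟨⟨⟨⟨-, h1⟩, h2⟩, -⟩, -⟩, hz⟩, hy⟩ := h
    refine ⟨h1, h2, ?_, S _ _ _ _ _ h1 h2 hy⟩
    by_contra hne
    simp [chZEx, hne] at hz
  refine ⟨?_, ?_, ?_, ?_, ?_, ?_⟩
  · unfold H; rw [DA1, dist_id]
  · unfold H; rw [DA2, dist_id]
  · unfold MI
    rw [H_congr μ (fun ω => (ω.2.2.1, ω.1)) (fun ω => ω.2.2.1), H1]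
    · ring
    · rintro ⟨x1, x2, u1, u2, a1, a2, ⟨z1, z2⟩, y⟩ ⟨x1', x2', u1', u2', a1', a2', ⟨z1', z2'⟩, y'⟩ h h'
      have k := supp _ _ _ _ _ _ _ _ _ h
      have k' := supp _ _ _ _ _ _ _ _ _ h'
      simp only [Prod.mk.injEq, and_iff_left_iff_imp]
      rintro rfl
      exact F1 _ _ _ k.1 k'.1
  · unfold MI
    rw [H_congr μ (fun ω => (ω.2.2.2.1, ω.2.1)) (fun ω => ω.2.2.2.1), H2]
    · ring
    · rintro ⟨x1, x2, u1, u2, a1, a2, ⟨z1, z2⟩, y⟩ ⟨x1', x2', u1', u2', a1', a2', ⟨z1', z2'⟩, y'⟩ h h'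
      have k := supp _ _ _ _ _ _ _ _ _ h
      have k' := supp _ _ _ _ _ _ _ _ _ h'
      simp only [Prod.mk.injEq, and_iff_left_iff_imp]
      rintro rfl
      exact F2 _ _ _ k.2.1 k'.2.1
  · unfold CMI
    rw [H_congr μ (fun ω => ((ω.1, ω.2.2.2.2.2.2.2), ω.2.1)) (fun ω => (ω.1, ω.2.1)),
      H_congr μ (fun ω => (ω.2.2.1, (ω.1, ω.2.2.2.2.2.2.2), ω.2.1)) (fun ω => (ω.2.2.1, ω.2.1)),
      H12, H2]
    · ring
    · rintro ⟨x1, x2, u1, u2, a1, a2, ⟨z1, z2⟩, y⟩ ⟨x1', x2', u1', u2', a1', a2', ⟨z1', z2'⟩, y'⟩ h h'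
      obtain ⟨k1, -, -, ky⟩ := supp _ _ _ _ _ _ _ _ _ h
      obtain ⟨k1', -, -, ky'⟩ := supp _ _ _ _ _ _ _ _ _ h'
      simp only [Prod.mk.injEq]
      constructor
      · rintro ⟨e1, -, e2⟩; exact ⟨e1, e2⟩
      · rintro ⟨rfl, rfl⟩
        have := F1 _ _ _ k1 k1'
        subst this
        exact ⟨rfl, ⟨rfl, ky.trans ky'.symm⟩, rfl⟩
    · rintro ⟨x1, x2, u1, u2, a1, a2, ⟨z1, z2⟩, y⟩ ⟨x1', x2', u1', u2', a1', a2', ⟨z1', z2'⟩, y'⟩ h h'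
      obtain ⟨k1, -, -, ky⟩ := supp _ _ _ _ _ _ _ _ _ h
      obtain ⟨k1', -, -, ky'⟩ := supp _ _ _ _ _ _ _ _ _ h'
      simp only [Prod.mk.injEq]
      constructor
      · rintro ⟨⟨e1, -⟩, e2⟩; exact ⟨e1, e2⟩
      · rintro ⟨rfl, rfl⟩
        exact ⟨⟨rfl, ky.trans ky'.symm⟩, rfl⟩
  · unfold condEnt
    rw [H_congr μ (fun ω => (ω.2.2.2.2.1, ω.2.2.2.2.2.2.1)) (fun ω => ω.2.2.2.2.2.2.1), sub_self]
    rintro ⟨x1, x2, u1, u2, a1, a2, ⟨z1, z2⟩, y⟩ ⟨x1', x2', u1', u2', a1', a2', ⟨z1', z2'⟩, y'⟩ h h'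
    obtain ⟨-, -, kz, -⟩ := supp _ _ _ _ _ _ _ _ _ h
    obtain ⟨-, -, kz', -⟩ := supp _ _ _ _ _ _ _ _ _ h'
    subst kz kz'
    simp only [Prod.mk.injEq, and_iff_right_iff_imp]
    rintro ⟨rfl, rfl⟩
    rfl

end Core

/-- **Proposition 1.**  For the Example-1 target distribution, perfect legitimate
channel `Ỹ = (X̃1, X̃2)` and eavesdropper channel `Z̃ = (X̃1, X̃2 ⊕ N)` with
`N ∼ Bern(p)`, `p ∈ [0, 1/2]`: secure channel simulation is feasible — i.e. there are
finite auxiliary variables `U1, U2` with the factorized pmf below, matching the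
target, and satisfying `H(X̃1) ≥ I(U1;X1)`, `H(X̃2) ≥ I(U2;X2)` and
`R01 ≥ I(U1;X1,Y|X2) − H(X̃1|Z̃)` — if and only if `H(X̃1) ≥ 1`, `H(X̃2) ≥ 1`
(hence `H(X̃1, X̃2) ≥ 2`) and `R01 ≥ 1`. -/
theorem example1_characterization
    (p : ℝ) (hp : p ∈ Set.Icc (0 : ℝ) (1 / 2)) (R01 : ℝ)
    (pXt1 pXt2 : Bool → ℝ) (hpXt1 : IsPMF pXt1) (hpXt2 : IsPMF pXt2) :
    (∃ (U1 U2 : Type) (_ : Fintype U1) (_ : Fintype U2)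
      (pU1 : Bool → U1 → ℝ) (pU2 : Bool → U2 → ℝ)
      (pYc : U1 → U2 → Option Bool → ℝ)
      (μ : Omega4 U1 U2 → ℝ),
      (∀ x, IsPMF (pU1 x)) ∧ (∀ x, IsPMF (pU2 x)) ∧
      (∀ u1 u2, IsPMF (pYc u1 u2)) ∧
      (∀ x1 x2 u1 u2 a1 a2 z y,
        μ (x1, x2, u1, u2, a1, a2, z, y) =
          (1 / 4) * pU1 x1 u1 * pU2 x2 u2 * pXt1 a1 * pXt2 a2 *
            chZEx p (a1, a2) z * pYc u1 u2 y) ∧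
      (∀ x1 x2 y,
        (∑ u1 : U1, ∑ u2 : U2, ∑ a1 : Bool, ∑ a2 : Bool, ∑ z : Bool × Bool,
          μ (x1, x2, u1, u2, a1, a2, z, y)) = qEx (x1, x2, y)) ∧
      H μ (fun ω => ω.2.2.2.2.1) ≥ MI μ (fun ω => ω.2.2.1) (fun ω => ω.1) ∧
      H μ (fun ω => ω.2.2.2.2.2.1) ≥ MI μ (fun ω => ω.2.2.2.1) (fun ω => ω.2.1) ∧
      R01 ≥ CMI μ (fun ω => ω.2.2.1) (fun ω => (ω.1, ω.2.2.2.2.2.2.2)) (fun ω => ω.2.1)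
        - condEnt μ (fun ω => ω.2.2.2.2.1) (fun ω => ω.2.2.2.2.2.2.1))
    ↔
    (H pXt1 (fun a => a) ≥ 1 ∧ H pXt2 (fun a => a) ≥ 1 ∧
      H (fun v : Bool × Bool => pXt1 v.1 * pXt2 v.2) (fun v => v) ≥ 2 ∧
      R01 ≥ 1) := by
  constructor
  · rintro ⟨U1, U2, i1, i2, pU1, pU2, pYc, μ, hU1, hU2, hY, hμ, hq, h1, h2, h3⟩
    obtain ⟨c1, c2, c3, c4, c5, c6⟩ := core hpXt1 hpXt2 hU1 hU2 hY hμ hq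
    rw [c1, c3] at h1
    rw [c2, c4] at h2
    rw [c5, c6] at h3
    refine ⟨h1, h2, ?_, by linarith⟩
    rw [H_prod _ _ hpXt1 hpXt2]
    linarith
  · rintro ⟨h1, h2, -, h3⟩
    have pm : ∀ x : Bool, IsPMF (fun u : Bool => if u = x then (1 : ℝ) else 0) := fun x =>
      ⟨fun a => by dsimp only; split_ifs <;> norm_num, by simp⟩
    have pmY : ∀ x1 x2 : Bool,
        IsPMF (fun y : Option Bool => if y = yOf x1 x2 then (1 : ℝ) else 0) := fun x1 x2 =>
      ⟨fun a => by dsimp only; split_ifs <;> norm_num, by simp⟩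
    let μ : Omega4 Bool Bool → ℝ := fun ω =>
      (1 / 4) * (if ω.2.2.1 = ω.1 then (1 : ℝ) else 0) * (if ω.2.2.2.1 = ω.2.1 then (1 : ℝ) else 0)
        * pXt1 ω.2.2.2.2.1 * pXt2 ω.2.2.2.2.2.1
        * chZEx p (ω.2.2.2.2.1, ω.2.2.2.2.2.1) ω.2.2.2.2.2.2.1
        * (if ω.2.2.2.2.2.2.2 = yOf ω.2.2.1 ω.2.2.2.1 then (1 : ℝ) else 0)
    have hμ : ∀ x1 x2 u1 u2 a1 a2 z y,
        μ (x1, x2, u1, u2, a1, a2, z, y) =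
          (1 / 4) * (fun x u : Bool => if u = x then (1 : ℝ) else 0) x1 u1
            * (fun x u : Bool => if u = x then (1 : ℝ) else 0) x2 u2 * pXt1 a1 * pXt2 a2 *
            chZEx p (a1, a2) z *
            (fun (u1 u2 : Bool) (y : Option Bool) => if y = yOf u1 u2 then (1 : ℝ) else 0) u1 u2 y :=
      fun _ _ _ _ _ _ _ _ => rfl
    have hq : ∀ x1 x2 y,
        (∑ u1 : Bool, ∑ u2 : Bool, ∑ a1 : Bool, ∑ a2 : Bool, ∑ z : Bool × Bool,
          μ (x1, x2, u1, u2, a1, a2, z, y)) = qEx (x1, x2, y) := by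
      intro x1 x2 y
      simp only [hμ]
      simp only [← Finset.mul_sum, ← Finset.sum_mul, sum_chZEx, hpXt1.2, hpXt2.2, mul_one]
      cases x1 <;> cases x2 <;> simp [qEx, yOf]
    obtain ⟨c1, c2, c3, c4, c5, c6⟩ := core hpXt1 hpXt2 pm pm pmY hμ hq
    refine ⟨Bool, Bool, inferInstance, inferInstance, _, _, _, μ, pm, pm, pmY, hμ, hq, ?_, ?_, ?_⟩
    · rw [c1, c3]; exact h1
    · rw [c2, c4]; exact h2
    · rw [c5, c6]; linarith


end Example1

end SecCoord
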